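/- arXiv:0908.3806 — 2 statements merged into one kernel-verified Lean document; each statement's English description precedes it below -/
import Mathlib

section
/- The canonical action of S on a principal S-bundle is principal, i.e. free and proper. Precisely: let S be an abelian group bundle over B with bundle map p, let X be a principal S-bundle with bundle map q and trivialization ({U_i}, {φ_i}, {γ_ij}), and equip X with the canonical action s·x = φ_i⁻¹(s·φ_i(x)) (for p(s) = q(x) ∈ U_i). Then: (1) the action is free, i.e. if p(s) = q(x) and s·x = x then s = e(q(x)); and (2) the action is proper, i.e. the map S*X → X × X given by (s,x) ↦ (s·x, x), where S*X = {(s,x) ∈ S × X : p(s) = q(x)} carries the subspace topology, is a proper map. -/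
/-- An abelian (groupoid) group bundle over a base space `B`: a bundle map `p`,
a continuous unit section `e`, fibrewise multiplication and inversion, making each
fibre `p ⁻¹' {u}` an abelian group. -/
structure AbelianGroupBundle (S B : Type*) [TopologicalSpace S] [TopologicalSpace B] where
  p : S → B
  e : B → S
  mul : S → S → S
  inv : S → S
  continuous_p : Continuous p
  isOpenMap_p : IsOpenMap p
  surjective_p : Function.Surjective p
  continuous_e : Continuous e
  p_e : ∀ b, p (e b) = b
  continuous_inv : Continuous inv
  p_inv : ∀ s, p (inv s) = p s
  continuous_mul : Continuous (fun st : {st : S × S // p st.1 = p st.2} => mul st.1.1 st.1.2)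
  p_mul : ∀ s t, p s = p t → p (mul s t) = p s
  mul_assoc' : ∀ s t u, p s = p t → p t = p u → mul (mul s t) u = mul s (mul t u)
  mul_comm' : ∀ s t, p s = p t → mul s t = mul t s
  e_mul : ∀ s, mul (e (p s)) s = s
  mul_inv_self : ∀ s, mul s (inv s) = e (p s)

/-- A trivialization of a principal `S`-bundle `q : X → B`: an open cover `U`,
trivializing homeomorphisms `φ i : q ⁻¹' (U i) → p ⁻¹' (U i)` (encoded by a pair of
mutually inverse maps continuous on the relevant sets) commuting with the bundle maps,
and continuous transition sections `γ i j` satisfying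
`φ i (φ j ⁻¹ s) = γ i j (p s) · s`. -/
structure PrincipalTrivialization {S B X : Type*} [TopologicalSpace S] [TopologicalSpace B]
    [TopologicalSpace X] (GB : AbelianGroupBundle S B) (q : X → B) (I : Type*) where
  U : I → Set B
  isOpen_U : ∀ i, IsOpen (U i)
  covers : ∀ b, ∃ i, b ∈ U i
  φ : I → X → S
  φinv : I → S → X
  continuousOn_φ : ∀ i, ContinuousOn (φ i) (q ⁻¹' (U i))
  continuousOn_φinv : ∀ i, ContinuousOn (φinv i) (GB.p ⁻¹' (U i))
  p_φ : ∀ i x, q x ∈ U i → GB.p (φ i x) = q x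
  q_φinv : ∀ i s, GB.p s ∈ U i → q (φinv i s) = GB.p s
  φinv_φ : ∀ i x, q x ∈ U i → φinv i (φ i x) = x
  φ_φinv : ∀ i s, GB.p s ∈ U i → φ i (φinv i s) = s
  γ : I → I → B → S
  continuousOn_γ : ∀ i j, ContinuousOn (γ i j) (U i ∩ U j)
  p_γ : ∀ i j, ∀ u ∈ U i ∩ U j, GB.p (γ i j u) = u
  transition : ∀ i j s, GB.p s ∈ U i → GB.p s ∈ U j →
    φ i (φinv j s) = GB.mul (γ i j (GB.p s)) s

/-- The canonical action of `S` on a principal `S`-bundle `X`, defined locally by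
`s · x = φ i ⁻¹ (s · φ i x)` whenever `p s = q x ∈ U i`. -/
def IsCanonicalAction {S B X : Type*} [TopologicalSpace S] [TopologicalSpace B]
    [TopologicalSpace X] {GB : AbelianGroupBundle S B} {q : X → B} {I : Type*}
    (T : PrincipalTrivialization GB q I) (act : S → X → X) : Prop :=
  ∀ i s x, GB.p s = q x → q x ∈ T.U i → act s x = T.φinv i (GB.mul s (T.φ i x))

open Filter Topology in
theorem AbelianGroupBundle.tendsto_mul {S B : Type*} [TopologicalSpace S] [TopologicalSpace B]
    (GB : AbelianGroupBundle S B) {α : Type*} {l : Filter α} {f g : α → S} {a b : S}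
    (hf : Tendsto f l (𝓝 a)) (hg : Tendsto g l (𝓝 b)) (hab : GB.p a = GB.p b)
    (h : ∀ᶠ z in l, GB.p (f z) = GB.p (g z)) :
    Tendsto (fun z => GB.mul (f z) (g z)) l (𝓝 (GB.mul a b)) := by
  have hc : ContinuousOn (fun st : S × S => GB.mul st.1 st.2) {st | GB.p st.1 = GB.p st.2} :=
    continuousOn_iff_continuous_domRestrict.2 GB.continuous_mul
  have h1 := hc (a, b) hab
  exact h1.tendsto.comp (tendsto_nhdsWithin_iff.2 ⟨hf.prodMk_nhds hg, h⟩)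

theorem AbelianGroupBundle.mul_mul_inv {S B : Type*} [TopologicalSpace S] [TopologicalSpace B]
    (GB : AbelianGroupBundle S B) {s t : S} (h : GB.p s = GB.p t) :
    GB.mul (GB.mul s t) (GB.inv t) = s := by
  rw [GB.mul_assoc' s t _ h (GB.p_inv t).symm, GB.mul_inv_self, ← h,
    GB.mul_comm' _ _ (GB.p_e _).symm, GB.e_mul]

open Filter Topology in
/-- The canonical action of `S` on a principal `S`-bundle is principal: it is free
(`s · x = x` forces `s = e (q x)`) and proper (the map `(s, x) ↦ (s · x, x)` from
`S * X = {(s, x) : p s = q x}` to `X × X` is a proper map). -/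
theorem canonical_action_is_principal
    {S B X : Type*} [TopologicalSpace S] [TopologicalSpace B] [TopologicalSpace X]
    [LocallyCompactSpace S] [T2Space S] [LocallyCompactSpace B] [T2Space B]
    [LocallyCompactSpace X] [T2Space X] {I : Type*}
    (GB : AbelianGroupBundle S B) (q : X → B)
    (hq : Continuous q) (hqs : Function.Surjective q)
    (T : PrincipalTrivialization GB q I)
    (act : S → X → X) (hact : IsCanonicalAction T act) :
    (∀ s x, GB.p s = q x → act s x = x → s = GB.e (q x)) ∧
    IsProperMap (fun sx : {sx : S × X // GB.p sx.1 = q sx.2} =>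
      (act sx.1.1 sx.1.2, sx.1.2)) := by
  have hpm : ∀ i s x, GB.p s = q x → q x ∈ T.U i → GB.p (GB.mul s (T.φ i x)) = q x :=
    fun i s x h hi => (GB.p_mul _ _ (h.trans (T.p_φ i x hi).symm)).trans h
  have hφact : ∀ i s x, GB.p s = q x → q x ∈ T.U i →
      T.φ i (act s x) = GB.mul s (T.φ i x) := fun i s x h hi => by
    rw [hact i s x h hi, T.φ_φinv]
    rw [hpm i s x h hi]; exact hi
  have hqact : ∀ s x, GB.p s = q x → q (act s x) = q x := fun s x h => by
    obtain ⟨i, hi⟩ := T.covers (q x)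
    rw [hact i s x h hi, T.q_φinv, hpm i s x h hi]
    rw [hpm i s x h hi]; exact hi
  have hrec : ∀ i s x, GB.p s = q x → q x ∈ T.U i →
      GB.mul (T.φ i (act s x)) (GB.inv (T.φ i x)) = s := fun i s x h hi => by
    rw [hφact i s x h hi, GB.mul_mul_inv (h.trans (T.p_φ i x hi).symm)]
  refine ⟨fun s x h hx => ?_, ?_⟩
  · obtain ⟨i, hi⟩ := T.covers (q x)
    have := hrec i s x h hi
    rw [hx, GB.mul_inv_self, T.p_φ i x hi] at this
    exact this.symm
  have hφt : ∀ i x, q x ∈ T.U i → Tendsto (T.φ i) (𝓝 x) (𝓝 (T.φ i x)) := fun i x hi =>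
    (T.continuousOn_φ i).continuousAt (((T.isOpen_U i).preimage hq).mem_nhds hi)
  have hcont : Continuous (fun sx : {sx : S × X // GB.p sx.1 = q sx.2} =>
      (act sx.1.1 sx.1.2, sx.1.2)) := by
    refine Continuous.prodMk ?_ (continuous_snd.comp continuous_subtype_val)
    rw [continuous_iff_continuousAt]
    rintro ⟨⟨s, x⟩, h⟩
    obtain ⟨i, hi⟩ := T.covers (q x)
    have c1 : Tendsto (fun sx : {sx : S × X // GB.p sx.1 = q sx.2} => sx.1.1)
        (𝓝 ⟨(s, x), h⟩) (𝓝 s) :=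
      (continuous_fst.comp continuous_subtype_val).tendsto _
    have c2 : Tendsto (fun sx : {sx : S × X // GB.p sx.1 = q sx.2} => sx.1.2)
        (𝓝 ⟨(s, x), h⟩) (𝓝 x) :=
      (continuous_snd.comp continuous_subtype_val).tendsto _
    have ev : ∀ᶠ sx : {sx : S × X // GB.p sx.1 = q sx.2} in 𝓝 ⟨(s, x), h⟩,
        q sx.1.2 ∈ T.U i :=
      c2.eventually (((T.isOpen_U i).preimage hq).mem_nhds hi)
    have c3 := GB.tendsto_mul c1 ((hφt i x hi).comp c2) (h.trans (T.p_φ i x hi).symm)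
      (ev.mono fun z hz => z.2.trans (T.p_φ i _ hz).symm)
    have hm : GB.mul s (T.φ i x) ∈ GB.p ⁻¹' T.U i := by
      show GB.p _ ∈ T.U i
      rw [hpm i s x h hi]; exact hi
    have c4 := ((T.continuousOn_φinv i).continuousAt
      (((T.isOpen_U i).preimage GB.continuous_p).mem_nhds hm)).tendsto.comp c3
    show Tendsto _ _ (𝓝 (act s x))
    rw [hact i s x h hi]
    exact c4.congr' (ev.mono fun z hz => (hact i _ _ z.2 hz).symm)
  rw [isProperMap_iff_ultrafilter]
  refine ⟨hcont, ?_⟩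
  rintro F ⟨y, x⟩ hF
  have ty : Tendsto (fun sx : {sx : S × X // GB.p sx.1 = q sx.2} => act sx.1.1 sx.1.2)
      F (𝓝 y) := (continuous_fst.tendsto _).comp hF
  have tx : Tendsto (fun sx : {sx : S × X // GB.p sx.1 = q sx.2} => sx.1.2)
      F (𝓝 x) := (continuous_snd.tendsto _).comp hF
  have hyx : q y = q x := by
    refine tendsto_nhds_unique ((hq.tendsto _).comp ty) (((hq.tendsto _).comp tx).congr ?_)
    intro z
    exact (hqact _ _ z.2).symm
  obtain ⟨i, hi⟩ := T.covers (q x)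
  have hiy : q y ∈ T.U i := hyx ▸ hi
  have ev : ∀ᶠ sx : {sx : S × X // GB.p sx.1 = q sx.2} in F, q sx.1.2 ∈ T.U i :=
    tx.eventually (((T.isOpen_U i).preimage hq).mem_nhds hi)
  have hp0 : GB.p (T.φ i y) = GB.p (GB.inv (T.φ i x)) := by
    rw [GB.p_inv, T.p_φ i y hiy, T.p_φ i x hi, hyx]
  have ts : Tendsto (fun sx : {sx : S × X // GB.p sx.1 = q sx.2} => sx.1.1) F
      (𝓝 (GB.mul (T.φ i y) (GB.inv (T.φ i x)))) := by
    refine (GB.tendsto_mul ((hφt i y hiy).comp ty)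
      ((GB.continuous_inv.tendsto _).comp ((hφt i x hi).comp tx)) hp0 ?_).congr' ?_
    · refine ev.mono fun z hz => ?_
      have h1 := hqact _ _ z.2
      simp only [Function.comp]
      rw [GB.p_inv, T.p_φ i _ hz, T.p_φ i _ (h1 ▸ hz), h1]
    · exact ev.mono fun z hz => hrec i _ _ z.2 hz
  have hs0 : GB.p (GB.mul (T.φ i y) (GB.inv (T.φ i x))) = q x := by
    rw [GB.p_mul _ _ hp0, T.p_φ i y hiy, hyx]
  have hle : (F : Filter _) ≤ 𝓝 (⟨(_, x), hs0⟩ : {sx : S × X // GB.p sx.1 = q sx.2}) :=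
    (tendsto_subtype_rng (f := id)).2 (ts.prodMk_nhds tx)
  exact ⟨_, tendsto_nhds_unique ((hcont.tendsto _).mono_left hle) hF, hle⟩
end

section
/- A free, proper, fibre-transitive action with a local section yields a local trivialization. Precisely: let S be an abelian group bundle over B with bundle map p, let X be a locally compact Hausdorff space with a continuous surjection q : X → B, and suppose S acts on X over B and the action is free, proper, and fibre-transitive. Let U ⊆ B be open and let σ : U → X be a continuous section of q. Then the map ψ : p⁻¹(U) → q⁻¹(U) defined by ψ(s) = s·σ(p(s)) is a homeomorphism satisfying q(ψ(s)) = p(s) for all s ∈ p⁻¹(U). -/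
/-- A continuous action of the group bundle `S` on a space `X` over `B` (with
structure map `q : X → B`). -/
structure BundleAction {S B X : Type*} [TopologicalSpace S] [TopologicalSpace B]
    [TopologicalSpace X] (GB : AbelianGroupBundle S B) (q : X → B) where
  act : S → X → X
  continuous_act :
    Continuous (fun sx : {sx : S × X // GB.p sx.1 = q sx.2} => act sx.1.1 sx.1.2)
  q_act : ∀ s x, GB.p s = q x → q (act s x) = q x
  act_e : ∀ x, act (GB.e (q x)) x = x
  act_act : ∀ s t x, GB.p s = q x → GB.p t = q x → act s (act t x) = act (GB.mul s t) x

/-- A free, proper, fibre-transitive action together with a continuous local section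
`σ` of `q` over an open set `U` yields a local trivialization: the map
`ψ : s ↦ s · σ (p s)` is a homeomorphism of `p ⁻¹' U` onto `q ⁻¹' U` satisfying
`q (ψ s) = p s`. -/
theorem free_proper_transitive_action_local_trivialization
    {S B X : Type*} [TopologicalSpace S] [TopologicalSpace B] [TopologicalSpace X]
    [LocallyCompactSpace S] [T2Space S] [LocallyCompactSpace B] [T2Space B]
    [LocallyCompactSpace X] [T2Space X]
    (GB : AbelianGroupBundle S B) (q : X → B)
    (hq : Continuous q) (hqs : Function.Surjective q)
    (A : BundleAction GB q)
    (hfree : ∀ s x, GB.p s = q x → A.act s x = x → s = GB.e (q x))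
    (hproper : IsProperMap (fun sx : {sx : S × X // GB.p sx.1 = q sx.2} =>
      (A.act sx.1.1 sx.1.2, sx.1.2)))
    (htrans : ∀ x y, q x = q y → ∃ s, GB.p s = q x ∧ A.act s x = y)
    (U : Set B) (hUopen : IsOpen U)
    (σ : B → X) (hσcont : ContinuousOn σ U) (hσsec : ∀ u ∈ U, q (σ u) = u) :
    ContinuousOn (fun s => A.act s (σ (GB.p s))) (GB.p ⁻¹' U) ∧
    (∀ s, GB.p s ∈ U → q (A.act s (σ (GB.p s))) = GB.p s) ∧
    ∃ ψinv : X → S,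
      ContinuousOn ψinv (q ⁻¹' U) ∧
      (∀ x, q x ∈ U → GB.p (ψinv x) = q x) ∧
      (∀ s, GB.p s ∈ U → ψinv (A.act s (σ (GB.p s))) = s) ∧
      (∀ x, q x ∈ U → A.act (ψinv x) (σ (GB.p (ψinv x))) = x) := by
  classical
  have hinj : ∀ s t x, GB.p s = q x → GB.p t = q x → A.act s x = A.act t x → s = t := by
    intro s t x hs ht h
    have hi : GB.p (GB.inv t) = q x := (GB.p_inv t).trans ht
    have h1 : A.act (GB.mul (GB.inv t) s) x = x := by
      rw [← A.act_act _ _ _ hi hs, h, A.act_act _ _ _ hi ht,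
        GB.mul_comm' _ _ (GB.p_inv t), GB.mul_inv_self, ht, A.act_e]
    have h2 := hfree _ x ((GB.p_mul _ _ (hi.trans hs.symm)).trans hi) h1
    calc s = GB.mul (GB.e (GB.p s)) s := (GB.e_mul s).symm
      _ = GB.mul (GB.mul t (GB.inv t)) s := by rw [GB.mul_inv_self, hs, ht]
      _ = GB.mul t (GB.mul (GB.inv t) s) :=
        GB.mul_assoc' _ _ _ (ht.trans hi.symm) (hi.trans hs.symm)
      _ = GB.mul t (GB.e (GB.p t)) := by rw [h2, ht]
      _ = GB.mul (GB.e (GB.p t)) t := GB.mul_comm' _ _ (GB.p_e _).symm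
      _ = t := GB.e_mul t
  have hemb : Topology.IsClosedEmbedding (fun sx : {sx : S × X // GB.p sx.1 = q sx.2} =>
      (A.act sx.1.1 sx.1.2, sx.1.2)) := by
    refine .of_continuous_injective_isClosedMap hproper.continuous ?_ hproper.isClosedMap
    rintro ⟨⟨s, x⟩, hs⟩ ⟨⟨t, y⟩, ht⟩ h
    simp only [Prod.mk.injEq] at h hs ht
    obtain ⟨h, rfl⟩ := h
    have := hinj s t x hs ht h
    subst this
    rfl
  have hq2 : ∀ s, GB.p s ∈ U → q (A.act s (σ (GB.p s))) = GB.p s := fun s hs => by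
    rw [A.q_act _ _ (hσsec _ hs).symm, hσsec _ hs]
  have hex : ∀ x, ∃ s, q x ∈ U → GB.p s = q x ∧ A.act s (σ (q x)) = x := by
    intro x
    by_cases hx : q x ∈ U
    · obtain ⟨s, h1, h2⟩ := htrans (σ (q x)) x (hσsec _ hx)
      exact ⟨s, fun _ => ⟨h1.trans (hσsec _ hx), h2⟩⟩
    · exact ⟨GB.e (q x), fun h => absurd h hx⟩
  choose ψ hψ using hex
  refine ⟨?_, hq2, ψ, ?_, fun x hx => (hψ x hx).1, ?_, ?_⟩
  · rw [continuousOn_iff_continuous_restrict]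
    have h1 : Continuous (fun s : GB.p ⁻¹' U => σ (GB.p s.1)) :=
      hσcont.comp_continuous (GB.continuous_p.comp continuous_subtype_val) (fun s => s.2)
    exact A.continuous_act.comp
      (Continuous.subtype_mk (continuous_subtype_val.prodMk h1)
        (fun s => (hσsec _ s.2).symm))
  · rw [continuousOn_iff_continuous_restrict]
    have h1 : Continuous (fun x : q ⁻¹' U => σ (q x.1)) :=
      hσcont.comp_continuous (hq.comp continuous_subtype_val) (fun s => s.2)
    let g : q ⁻¹' U → {sx : S × X // GB.p sx.1 = q sx.2} := fun x =>
      ⟨(ψ x.1, σ (q x.1)), (hψ x.1 x.2).1.trans (hσsec _ x.2).symm⟩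
    have hg : Continuous g := by
      rw [hemb.isInducing.continuous_iff]
      refine (continuous_subtype_val.prodMk h1).congr fun x => ?_
      exact Prod.ext (hψ x.1 x.2).2.symm rfl
    exact continuous_fst.comp (continuous_subtype_val.comp hg)
  · intro s hs
    have h0 := hq2 s hs
    have h := hψ (A.act s (σ (GB.p s))) (by rw [h0]; exact hs)
    rw [h0] at h
    exact hinj _ _ (σ (GB.p s)) (h.1.trans (hσsec _ hs).symm) (hσsec _ hs).symm h.2
  · intro x hx
    rw [(hψ x hx).1]
    exact (hψ x hx).2
end
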